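/- arXiv:math/9810047 — 2 statements merged into one kernel-verified Lean document; each statement's English description precedes it below -/
import Mathlib

section
/- Let T be the central limit operator on probability measures on ℝ, Tμ = (μ ∗ μ) ∘ S_{1/√2}. A probability measure μ on ℝ satisfies Tμ = μ if and only if μ is a centered Gaussian measure, i.e. there exists v ≥ 0 such that μ is the Gaussian measure with mean 0 and variance v (where variance 0 means the Dirac mass at 0). -/
open MeasureTheory ProbabilityTheory
open scoped NNReal

open Filter Topology in
lemma cfp_func (μ : Measure ℝ) [IsProbabilityMeasure μ]
    (h : Measure.map (fun x : ℝ => x / Real.sqrt 2) (μ.conv μ) = μ) (t : ℝ) :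
    charFun μ t = charFun μ ((Real.sqrt 2)⁻¹ * t) ^ 2 := by
  have h2 : Measure.map (fun x : ℝ => (Real.sqrt 2)⁻¹ * x) (μ.conv μ) = μ := by
    simpa only [div_eq_inv_mul] using h
  conv_lhs => rw [← h2]
  rw [charFun_map_mul, charFun_conv, sq]

lemma cfp_iter (μ : Measure ℝ) [IsProbabilityMeasure μ]
    (h : ∀ t, charFun μ t = charFun μ ((Real.sqrt 2)⁻¹ * t) ^ 2) (n : ℕ) (t : ℝ) :
    charFun μ t = charFun μ (((Real.sqrt 2)⁻¹) ^ n * t) ^ (2 ^ n) := by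
  induction n with
  | zero => simp
  | succ n ih =>
    rw [ih, h, ← pow_mul, ← mul_assoc, ← pow_succ' (Real.sqrt 2)⁻¹, ← pow_succ' 2]

lemma cfp_bound (μ : Measure ℝ) [IsProbabilityMeasure μ] (s : ℝ)
    (h : ∀ t, charFun μ t = charFun μ ((Real.sqrt 2)⁻¹ * t) ^ 2)
    (hs : ∀ n : ℕ, ‖1 - charFun μ (((Real.sqrt 2)⁻¹) ^ n * s)‖ ≤ 1 / 4) (n : ℕ) :
    2 ^ n * ‖1 - charFun μ (((Real.sqrt 2)⁻¹) ^ n * s)‖ ≤ Real.log (4 / 3) := by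
  set b : ℕ → ℝ := fun n => ‖1 - charFun μ (((Real.sqrt 2)⁻¹) ^ n * s)‖ with hb
  have step : ∀ n, 1 - b n ≤ (1 - b (n + 1)) ^ 2 := by
    intro n
    have e : 1 - charFun μ (((Real.sqrt 2)⁻¹) ^ n * s) =
        2 * (1 - charFun μ (((Real.sqrt 2)⁻¹) ^ (n + 1) * s))
          - (1 - charFun μ (((Real.sqrt 2)⁻¹) ^ (n + 1) * s)) ^ 2 := by
      rw [h (((Real.sqrt 2)⁻¹) ^ n * s), ← mul_assoc, ← pow_succ']
      ring
    have := norm_sub_norm_le (2 * (1 - charFun μ (((Real.sqrt 2)⁻¹) ^ (n + 1) * s)))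
      ((1 - charFun μ (((Real.sqrt 2)⁻¹) ^ (n + 1) * s)) ^ 2)
    rw [← e, norm_mul, norm_pow] at this
    simp only [Complex.norm_ofNat] at this
    simp only [hb]
    nlinarith
  have all : ∀ n, 1 - b 0 ≤ (1 - b n) ^ (2 ^ n) := by
    intro n
    induction n with
    | zero => simp
    | succ n ih =>
      refine ih.trans ?_
      rw [pow_succ' 2 n, pow_mul]
      have := hs n
      exact pow_le_pow_left₀ (by simp only [hb]; linarith) (step n) _
  have h1 := all n
  have h2 : (1 - b n) ^ (2 ^ n) ≤ Real.exp (-(2 ^ n * b n)) := by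
    have : 1 - b n ≤ Real.exp (-b n) := by
      have := Real.add_one_le_exp (-b n); linarith
    calc _ ≤ (Real.exp (-b n)) ^ (2 ^ n) :=
          pow_le_pow_left₀ (by have := hs n; simp only [hb]; linarith) this _
      _ = _ := by rw [← Real.exp_nat_mul]; push_cast; ring_nf
  have h3 : (3 / 4 : ℝ) ≤ Real.exp (-(2 ^ n * b n)) := by
    have := hs 0
    refine le_trans ?_ (h1.trans h2)
    simp only [hb]; linarith
  have h5 := Real.log_le_log (by norm_num) h3
  rw [Real.log_exp] at h5
  have h6 : Real.log (3 / 4) = - Real.log (4 / 3) := by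
    rw [← Real.log_inv]; norm_num
  linarith

open Filter Topology in
lemma cfp_tend (s : ℝ) : Tendsto (fun n : ℕ => ((Real.sqrt 2)⁻¹) ^ n * s) atTop (𝓝 0) := by
  have h1 : (Real.sqrt 2)⁻¹ < 1 := inv_lt_one_of_one_lt₀ (by
    rw [Real.lt_sqrt] <;> norm_num)
  simpa using (tendsto_pow_atTop_nhds_zero_of_lt_one (by positivity) h1).mul_const s

open Filter Topology in
lemma cfp_exists (μ : Measure ℝ) [IsProbabilityMeasure μ] :
    ∃ s : ℝ, 0 < s ∧ ∀ n : ℕ, ‖1 - charFun μ (((Real.sqrt 2)⁻¹) ^ n * s)‖ ≤ 1 / 4 := by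
  have hc : Continuous (fun t => ‖1 - charFun μ t‖) := by
    have := continuous_charFun (μ := μ)
    fun_prop
  have h0 : Tendsto (fun n : ℕ => ‖1 - charFun μ (((Real.sqrt 2)⁻¹) ^ n * 1)‖) atTop (𝓝 0) := by
    have := (hc.tendsto 0).comp (cfp_tend 1)
    simpa [Function.comp_def] using this
  obtain ⟨N, hN⟩ := eventually_atTop.1 (h0.eventually_le_const (show (0 : ℝ) < 1 / 4 by norm_num))
  refine ⟨((Real.sqrt 2)⁻¹) ^ N, by positivity, fun n => ?_⟩
  have := hN (n + N) (by omega)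
  rwa [mul_one, pow_add] at this

lemma cfp_re (μ : Measure ℝ) [IsProbabilityMeasure μ] (t : ℝ) :
    Integrable (fun x => 1 - Real.cos (t * x)) μ ∧
    ∫ x, (1 - Real.cos (t * x)) ∂μ = (1 - charFun μ t).re := by
  have hi : Integrable (fun x => Real.cos (t * x)) μ :=
    Integrable.of_bound (C := 1) (by fun_prop) (.of_forall fun x => by
      simpa using Real.abs_cos_le_one _)
  have hi2 : Integrable (fun x : ℝ => Complex.exp (t * x * Complex.I)) μ :=
    Integrable.of_bound (C := 1) (by fun_prop) (.of_forall fun x => by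
      rw [← Complex.ofReal_mul, Complex.norm_exp_ofReal_mul_I])
  refine ⟨(integrable_const _).sub hi, ?_⟩
  rw [integral_sub (integrable_const _) hi, charFun_apply_real, Complex.sub_re]
  have := integral_re hi2
  simp only [RCLike.re_to_complex] at this
  rw [← this]
  simp only [← Complex.ofReal_mul, Complex.exp_ofReal_mul_I_re]
  simp

open Filter Topology in
lemma cfp_memLp (μ : Measure ℝ) [IsProbabilityMeasure μ]
    (h : ∀ t, charFun μ t = charFun μ ((Real.sqrt 2)⁻¹ * t) ^ 2) :
    Integrable (fun x : ℝ => x ^ 2) μ := by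
  obtain ⟨s, hs0, hs⟩ := cfp_exists μ
  set r : ℕ → ℝ := fun n => ((Real.sqrt 2)⁻¹) ^ n * s with hr
  have hr2 : ∀ n, 2 ^ n * (r n) ^ 2 = s ^ 2 := by
    intro n
    simp only [hr]
    rw [mul_pow, ← pow_mul, mul_comm n 2, pow_mul, inv_pow, Real.sq_sqrt (by norm_num), ← mul_assoc,
      ← mul_pow]
    norm_num
  set c : ℝ := 2 / Real.pi ^ 2 * s ^ 2 with hc
  have hc0 : 0 < c := by positivity
  have key : ∫⁻ x, ENNReal.ofReal (c * x ^ 2) ∂μ ≤ ENNReal.ofReal (Real.log (4 / 3)) := by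
    calc ∫⁻ x, ENNReal.ofReal (c * x ^ 2) ∂μ
        ≤ ∫⁻ x, liminf (fun n : ℕ => ENNReal.ofReal (2 ^ n * (1 - Real.cos (r n * x)))) atTop ∂μ := by
          refine lintegral_mono fun x => ?_
          refine le_liminf_of_le (by isBoundedDefault) ?_
          have ht : Tendsto (fun n => |r n * x|) atTop (𝓝 0) := by
            have := ((cfp_tend s).mul_const x).abs
            rw [zero_mul, abs_zero] at this
            exact this
          filter_upwards [ht.eventually_le_const Real.pi_pos] with n hn
          apply ENNReal.ofReal_le_ofReal
          have := Real.cos_le_one_sub_mul_cos_sq hn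
          have e : c * x ^ 2 = 2 ^ n * (2 / Real.pi ^ 2 * (r n * x) ^ 2) := by
            rw [hc, ← hr2 n]; ring
          rw [e]
          gcongr
          linarith
      _ ≤ liminf (fun n : ℕ => ∫⁻ x, ENNReal.ofReal (2 ^ n * (1 - Real.cos (r n * x))) ∂μ) atTop :=
          lintegral_liminf_le (fun n => by fun_prop)
      _ ≤ _ := by
          refine liminf_le_of_le (by isBoundedDefault) fun b hb => ?_
          obtain ⟨n, hn⟩ := hb.exists
          refine hn.trans ?_
          obtain ⟨hi, he⟩ := cfp_re μ (r n)
          rw [← ofReal_integral_eq_lintegral_ofReal (hi.const_mul _)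
            (.of_forall fun x => mul_nonneg (by positivity)
              (by have := Real.cos_le_one (r n * x); linarith)), integral_const_mul, he]
          apply ENNReal.ofReal_le_ofReal
          refine le_trans ?_ (cfp_bound μ s h hs n)
          gcongr
          exact Complex.re_le_norm _
  have hI : Integrable (fun x : ℝ => c * x ^ 2) μ := by
    refine ⟨by fun_prop, ?_⟩
    rw [hasFiniteIntegral_iff_ofReal (.of_forall fun x => by positivity)]
    exact key.trans_lt ENNReal.ofReal_lt_top
  exact (integrable_const_mul_iff (IsUnit.mk0 c hc0.ne') _).1 hI

lemma cfp_mean (μ : Measure ℝ) [IsProbabilityMeasure μ]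
    (h : Measure.map (fun x : ℝ => x / Real.sqrt 2) (μ.conv μ) = μ)
    (hI : Integrable (fun x : ℝ => x) μ) : ∫ x, x ∂μ = 0 := by
  have h1 : Integrable (fun x : ℝ => x / Real.sqrt 2) (μ.conv μ) := by
    have h2 := hI
    rw [← h, integrable_map_measure (by fun_prop) (by fun_prop)] at h2
    exact h2
  have h2 : ∫ x, x ∂μ = (∫ x, x ∂μ + ∫ x, x ∂μ) / Real.sqrt 2 := by
    conv_lhs => rw [← h]
    rw [integral_map (by fun_prop) (by fun_prop), integral_conv h1]
    simp_rw [integral_div]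
    congr 1
    have : ∀ x : ℝ, ∫ y, x + y ∂μ = x + ∫ y, y ∂μ := fun x => by
      rw [integral_add (integrable_const _) hI]; simp
    simp_rw [this]
    rw [integral_add hI (integrable_const _)]; simp
  have h3 : Real.sqrt 2 ≠ 0 := by positivity
  rw [eq_div_iff h3] at h2
  have h4 : Real.sqrt 2 < 2 := by rw [Real.sqrt_lt] <;> norm_num
  have : (∫ x, x ∂μ) * (2 - Real.sqrt 2) = 0 := by linarith
  rcases mul_eq_zero.1 this with h5 | h5
  · exact h5
  · linarith

open Filter Topology in
lemma cfp_forward (μ : Measure ℝ) [IsProbabilityMeasure μ]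
    (h : Measure.map (fun x : ℝ => x / Real.sqrt 2) (μ.conv μ) = μ) :
    ∃ v : ℝ≥0, μ = gaussianReal 0 v := by
  have hf := cfp_func μ h
  have hI2 := cfp_memLp μ hf
  have hL : MemLp (fun x : ℝ => x) 2 μ := (memLp_two_iff_integrable_sq (by fun_prop)).2 hI2
  have hI : Integrable (fun x : ℝ => x) μ := hL.integrable (by norm_num)
  have hm := cfp_mean μ h hI
  set v : ℝ := ∫ x, x ^ 2 ∂μ with hv
  have hv0 : 0 ≤ v := integral_nonneg fun x => by positivity
  refine ⟨v.toNNReal, ?_⟩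
  rcases hv0.eq_or_lt with h0 | hpos
  · rw [← h0, Real.toNNReal_zero, gaussianReal_zero_var]
    have h1 := (integral_eq_zero_iff_of_nonneg (fun x : ℝ => sq_nonneg x) hI2).1 h0.symm
    have h2 : (fun x : ℝ => x) =ᵐ[μ] fun _ => (0 : ℝ) := by
      filter_upwards [h1] with x hx
      simpa using hx
    have : μ.map (fun x : ℝ => x) = μ.map (fun _ => (0 : ℝ)) := Measure.map_congr h2
    simpa [Measure.map_const] using this
  · set σ := Real.sqrt v with hσ
    have hσ0 : 0 < σ := Real.sqrt_pos.2 hpos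
    have hσ2 : σ ^ 2 = v := Real.sq_sqrt hv0
    refine Measure.ext_of_charFun ?_
    ext t
    rw [charFun_gaussianReal]
    have hc := tendsto_charFun_inv_sqrt_mul_pow (P := μ) (X := fun x => σ⁻¹ * x) (by fun_prop)
      (by rw [integral_const_mul, hm, mul_zero])
      (by
        simp only [Pi.pow_apply, mul_pow]
        rw [integral_const_mul, ← hv, ← hσ2]
        field_simp) (σ * t)
    have hc2 := hc.comp (tendsto_pow_atTop_atTop_of_one_lt (show (1 : ℕ) < 2 by norm_num))
    have he : ((fun n : ℕ => charFun (μ.map fun x => σ⁻¹ * x) ((Real.sqrt n)⁻¹ * (σ * t)) ^ n) ∘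
        fun k : ℕ => 2 ^ k) = fun _ => charFun μ t := by
      ext k
      rw [cfp_iter μ hf k t]
      simp only [Function.comp_apply]
      rw [charFun_map_mul]
      congr 2
      have : Real.sqrt ((2 ^ k : ℕ) : ℝ) = Real.sqrt 2 ^ k := by
        push_cast
        rw [Real.sqrt_eq_iff_mul_self_eq (by positivity) (by positivity), ← mul_pow]
        norm_num
      rw [this, inv_pow]
      field_simp
    rw [he] at hc2
    rw [tendsto_nhds_unique tendsto_const_nhds hc2]
    congr 1
    rw [show ((v.toNNReal : ℝ) : ℂ) = ((σ ^ 2 : ℝ) : ℂ) by rw [Real.coe_toNNReal v hv0, hσ2]]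
    push_cast
    ring

/-- The central limit operator `T μ = (μ ∗ μ) ∘ S_{1/√2}`: the pushforward of the
convolution `μ ∗ μ` under `x ↦ x / √2`. A probability measure on `ℝ` is a fixed point
of `T` if and only if it is a centered Gaussian measure `gaussianReal 0 v` for some
variance `v ≥ 0` (where `gaussianReal 0 0` is the Dirac mass at `0`). -/
theorem clt_fixed_points (μ : Measure ℝ) [IsProbabilityMeasure μ] :
    Measure.map (fun x : ℝ => x / Real.sqrt 2) (μ.conv μ) = μ ↔
      ∃ v : ℝ≥0, μ = gaussianReal 0 v := by
  refine ⟨cfp_forward μ, ?_⟩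
  rintro ⟨v, rfl⟩
  rw [gaussianReal_conv_gaussianReal, gaussianReal_map_div_const]
  congr 1
  · simp
  · ext
    simp
end

section
/- Let T be the central limit operator on probability measures on ℝ, Tμ = (μ ∗ μ) ∘ S_{1/√2}. If μ is a probability measure on ℝ with ∫ x dμ(x) = 0 and ∫ x² dμ(x) = 1 (the identity being integrable and square-integrable with respect to μ), then the iterates Tⁿμ converge weakly, as n → ∞, to the standard Gaussian measure with mean 0 and variance 1. -/
open MeasureTheory ProbabilityTheory Filter Topology

/-- One step of the central limit operator. -/
lemma clt_aux (μ : Measure ℝ) [IsProbabilityMeasure μ] (n : ℕ) :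
    IsProbabilityMeasure ((fun ν : Measure ℝ =>
          Measure.map (fun x : ℝ => x / Real.sqrt 2) (ν.conv ν))^[n] μ) ∧
    ∀ t : ℝ, charFun ((fun ν : Measure ℝ =>
          Measure.map (fun x : ℝ => x / Real.sqrt 2) (ν.conv ν))^[n] μ) t =
      (charFun μ ((Real.sqrt ((2 ^ n : ℕ) : ℝ))⁻¹ * t)) ^ (2 ^ n) := by
  induction n with
  | zero => exact ⟨by simpa, by simp⟩
  | succ n ih =>
    rw [Function.iterate_succ_apply']
    obtain ⟨h1, h2⟩ := ih
    generalize ((fun ν : Measure ℝ =>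
          Measure.map (fun x : ℝ => x / Real.sqrt 2) (ν.conv ν))^[n] μ) = ρ at h1 h2 ⊢
    refine ⟨Measure.isProbabilityMeasure_map (by fun_prop), fun t => ?_⟩
    have e : (fun x : ℝ => x / Real.sqrt 2) = fun x => (Real.sqrt 2)⁻¹ * x := by
      ext x; rw [div_eq_inv_mul]
    beta_reduce
    rw [e]
    rw [charFun_map_mul, charFun_conv, h2, ← pow_two, ← pow_mul, ← pow_succ]
    congr 2
    push_cast
    rw [pow_succ, Real.sqrt_mul (by positivity), mul_inv, mul_assoc]

/-- Weak form of the CLT: if `μ` is a probability measure on `ℝ` with zero mean and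
unit variance (the identity being integrable and square-integrable), then the iterates
`Tⁿ μ` of the central limit operator `T μ = (μ ∗ μ) ∘ S_{1/√2}` converge weakly to the
standard Gaussian, i.e. integrals of every bounded continuous function converge. -/
theorem clt_iterates_tendsto_gaussian (μ : Measure ℝ) [IsProbabilityMeasure μ]
    (hint : Integrable (fun x : ℝ => x) μ)
    (hsq : Integrable (fun x : ℝ => x ^ 2) μ)
    (hmean : ∫ x, x ∂μ = 0) (hvar : ∫ x, x ^ 2 ∂μ = 1)
    (f : BoundedContinuousFunction ℝ ℝ) :
    Tendsto
      (fun n : ℕ =>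
        ∫ x, f x ∂((fun ν : Measure ℝ =>
          Measure.map (fun x : ℝ => x / Real.sqrt 2) (ν.conv ν))^[n] μ))
      atTop (𝓝 (∫ x, f x ∂(gaussianReal 0 1))) := by
  have hc : ∀ t : ℝ, Tendsto (fun n : ℕ => (charFun μ ((Real.sqrt (n : ℝ))⁻¹ * t)) ^ n) atTop
      (𝓝 (Complex.exp (- t ^ 2 / 2))) := by
    intro t
    have := tendsto_charFun_inv_sqrt_mul_pow (P := μ) (X := id) aemeasurable_id
      (by simpa using hmean) (by simpa using hvar) t
    simpa using this
  have key := (ProbabilityMeasure.tendsto_iff_tendsto_charFun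
    (μ := fun n => (⟨_, (clt_aux μ n).1⟩ : ProbabilityMeasure ℝ))
    (μ₀ := ⟨gaussianReal 0 1, inferInstance⟩)).2 (by
      intro t
      have h := (hc t).comp (tendsto_pow_atTop_atTop_of_one_lt (one_lt_two : (1:ℕ) < 2))
      simp only [ProbabilityMeasure.coe_mk, charFun_gaussianReal, (clt_aux μ _).2]
      simpa [neg_div, Function.comp_def] using h)
  exact ProbabilityMeasure.tendsto_iff_forall_integral_tendsto.1 key f
end
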